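/- Let s ∈ ℤ + 1/2 (a half-odd integer) and k ∈ ℤ. Let τ lie in the upper half-plane and z ∈ ℂ with z ∉ ℤ + ℤτ. Then Φ₁^{(−)[1/2,s]}(τ, z, −z + 2kτ) = −i e^{−2πikz} η(τ)³ / ϑ₁₁(τ, z). -/

import Mathlib

noncomputable section

open Complex

/-- `e2 w = exp (2 π i w)`; with `q = e^{2πiτ}`, the power `q^x` corresponds to `e2 (x * τ)`. -/
def e2 (w : ℂ) : ℂ := Complex.exp (2 * (Real.pi : ℂ) * Complex.I * w)

/-- Jacobi-type theta function `θ^{(ε)}_{n,m}(τ, z) = ∑_{j∈ℤ} ε^j q^{m(j+n/(2m))²} e^{2πim(j+n/(2m))z}`. -/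
def jtheta (ε n m τ z : ℂ) : ℂ :=
  ∑' j : ℤ, ε ^ j *
    e2 (m * ((j : ℂ) + n / (2 * m)) ^ 2 * τ + m * ((j : ℂ) + n / (2 * m)) * z)

/-- Mock theta function `Φ₁^{(ε)[m,s]}(τ, z₁, z₂)`. -/
def Phi1 (ε m s τ z₁ z₂ : ℂ) : ℂ :=
  ∑' j : ℤ, ε ^ j *
    e2 (m * (j : ℂ) * (z₁ + z₂) + s * z₁ + (m * (j : ℂ) ^ 2 + s * (j : ℂ)) * τ) /
      (1 - e2 (z₁ + (j : ℂ) * τ))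

/-- Dedekind eta function `η(τ) = q^{1/24} ∏_{k≥1} (1 - q^k)`. -/
def dedekindEta (τ : ℂ) : ℂ := e2 (τ / 24) * ∏' k : ℕ, (1 - e2 (((k : ℂ) + 1) * τ))

/-- Jacobi theta `ϑ₁₁(τ, z) = i ∑_{j∈ℤ} (−1)^j q^{(j+1/2)²/2} e^{2πi(j+1/2)z}`. -/
def theta11 (τ z : ℂ) : ℂ :=
  Complex.I * ∑' j : ℤ, (-1 : ℂ) ^ j *
    e2 (((j : ℂ) + 1 / 2) ^ 2 / 2 * τ + ((j : ℂ) + 1 / 2) * z)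

/-- Indefinite double sum `(∑_{j,p∈ℤ, 0<p≤j} − ∑_{j,p∈ℤ, j<p≤0}) f j p`. -/
def indefSum (f : ℤ → ℤ → ℂ) : ℂ :=
  ∑' jp : ℤ × ℤ,
    ((if 0 < jp.2 ∧ jp.2 ≤ jp.1 then f jp.1 jp.2 else 0) -
      (if jp.1 < jp.2 ∧ jp.2 ≤ 0 then f jp.1 jp.2 else 0))

/-- `g^{[m]}_{n,ν}(τ)`. -/
def gfun (m : ℂ) (n ν : ℤ) (τ : ℂ) : ℂ :=
  indefSum fun j p =>
    (-1 : ℂ) ^ j *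
      e2 (((m + 1 / 2) * ((j : ℂ) + (ν : ℂ) - ((ν : ℂ) + 1 / 2) / (2 * m + 1)) ^ 2 -
        m * ((p : ℂ) + (ν : ℂ) - (n : ℂ) / (2 * m)) ^ 2) * τ)

/-- `h^{[m]}_{n,ν}(τ, z)`. -/
def hfun (m : ℂ) (n ν : ℤ) (τ z : ℂ) : ℂ :=
  ∑' j : ℤ,
    e2 (m * (j : ℂ) * z + (n : ℂ) * z / 2 +
        (m * (j : ℂ) ^ 2 + (n : ℂ) * ((j : ℂ) + (ν : ℂ))) * τ) /
      (1 - e2 (m * z + 2 * m * ((j : ℂ) + (ν : ℂ)) * τ))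

/-- `G^{[m]}_{n,ν}(τ, z)`. -/
def Gfun (m : ℂ) (n ν : ℤ) (τ z : ℂ) : ℂ :=
  gfun m n ν τ * jtheta 1 (n : ℂ) m τ z +
    (-1 : ℂ) ^ ν * e2 (-(m * (ν : ℂ) ^ 2) * τ) *
      jtheta (-1) ((ν : ℂ) + 1 / 2) (m + 1 / 2) τ 0 * hfun m n ν τ z

/-- `F^{[m](a,b)}_{n,ν}(τ, z)`. -/
def Ffun (m : ℂ) (a b n ν : ℤ) (τ z : ℂ) : ℂ :=
  e2 ((a : ℂ) * z / 2 + (a : ℂ) ^ 2 / (4 * m) * τ) *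
    Gfun m n ν τ (z + (a : ℂ) * τ / m + (b : ℂ) / m)

/-- The coefficient `f_{j,k}` of Lemma 3.1:
`f_{j,k} = (−1)^j q^{(m+1/2)(j+s/(2m+1))² − k²/(4m)} e^{−2πijm(z₁−z₂)+πik(z₁−z₂)}`. -/
def fcoef (m s τ z₁ z₂ : ℂ) (j k : ℤ) : ℂ :=
  (-1 : ℂ) ^ j *
    e2 (((m + 1 / 2) * ((j : ℂ) + s / (2 * m + 1)) ^ 2 - (k : ℂ) ^ 2 / (4 * m)) * τ +
      (-((j : ℂ) * m) + (k : ℂ) / 2) * (z₁ - z₂))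


theorem hs_congr {f g : ℤ → ℂ} {a b : ℂ} (h : HasSum f a) (hf : ∀ j, g j = f j) (hb : b = a) :
    HasSum g b := by
  rw [hb, funext hf]; exact h

/-- inverse q-Pochhammer symbol, extended by zero -/
def ipoch (q : ℂ) (n : ℤ) : ℂ :=
  if 0 ≤ n then (∏ i ∈ Finset.range n.toNat, (1 - q ^ (i + 1)))⁻¹ else 0

theorem one_sub_qpow_ne {q : ℂ} (h1 : ‖q‖ < 1) (n : ℕ) : 1 - q ^ (n + 1) ≠ 0 := by
  intro h
  have h2 : ‖q ^ (n + 1)‖ < 1 := by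
    rw [norm_pow]; exact pow_lt_one₀ (norm_nonneg _) h1 (by omega)
  rw [← sub_eq_zero.mp h] at h2
  simp at h2

theorem ipoch_rec {q : ℂ} (h1 : ‖q‖ < 1) (n : ℤ) :
    ipoch q (n - 1) = (1 - q ^ n) * ipoch q n := by
  rcases lt_trichotomy n 0 with h | h | h
  · simp [ipoch, show ¬ (0 ≤ n) by omega, show ¬ (1 ≤ n) by omega]
  · subst h; simp [ipoch]
  · obtain ⟨m, rfl⟩ : ∃ m : ℕ, n = m + 1 := ⟨(n - 1).toNat, by omega⟩
    have h3 := one_sub_qpow_ne h1 m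
    have e : ((m : ℤ) + 1).toNat = m + 1 := by omega
    have e2 : q ^ ((m : ℤ) + 1) = q ^ (m + 1) := by exact_mod_cast zpow_natCast q (m + 1)
    simp only [ipoch, add_sub_cancel_right, e, e2, show (0 : ℤ) ≤ (m : ℤ) + 1 by omega,
      if_true, Int.toNat_natCast, Int.natCast_nonneg, Finset.prod_range_succ, mul_inv]
    field_simp

theorem ipoch_neg {q : ℂ} {n : ℤ} (h : n < 0) : ipoch q n = 0 := by
  simp [ipoch, show ¬ (0 ≤ n) by omega]

theorem ipoch_zero {q : ℂ} : ipoch q 0 = 1 := by simp [ipoch]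

/-- finite triple product -/
theorem fin_triple {q : ℂ} (h0 : q ≠ 0) (h1 : ‖q‖ < 1) (w : ℤ → ℂ) (w0 : w 0 = 1)
    (hw : ∀ j, w (j + 1) = -q ^ (j + 1) * w j) (x : ℂ) (hx : x ≠ 0) (N : ℕ) :
    HasSum (fun j : ℤ => (∏ i ∈ Finset.range (2 * N), (1 - q ^ (i + 1))) *
        (w j * x ^ j * (ipoch q (N - j) * ipoch q (N + j))))
      ((∏ i ∈ Finset.range N, (1 - x * q ^ (i + 1))) *
        ∏ i ∈ Finset.range N, (1 - q ^ i / x)) := by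
  induction N with
  | zero =>
    convert hasSum_single (0 : ℤ) ?_ using 1
    · simp [w0, ipoch_zero]
    · intro j hj
      rcases lt_or_gt_of_ne hj with h | h
      · simp [ipoch_neg h]
      · simp [ipoch_neg (show -j < 0 by omega)]
  | succ N ih =>
    have a1 := ih.mul_left (1 + q ^ (2 * N + 1))
    have a2 := ((Equiv.subRight (1 : ℤ)).hasSum_iff.mpr ih).mul_left (x * q ^ (N + 1))
    have a3 := ((Equiv.addRight (1 : ℤ)).hasSum_iff.mpr ih).mul_left (q ^ N / x)
    refine hs_congr ((a1.sub a2).sub a3) ?_ ?_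
    · intro j
      simp only [Function.comp, Equiv.subRight_apply, Equiv.coe_addRight]
      have r1 := ipoch_rec h1 (N + 1 - j)
      have r2 := ipoch_rec h1 (N + 1 + j)
      have r3 := ipoch_rec h1 (N - j)
      have r4 := ipoch_rec h1 (N + j)
      rw [show (N : ℤ) + 1 - j - 1 = N - j by ring] at r1
      rw [show (N : ℤ) + 1 + j - 1 = N + j by ring] at r2
      have w1 := hw j
      have w2 := hw (j - 1)
      rw [sub_add_cancel] at w2
      have w3 : w (j - 1) = - q ^ (-j) * w j := by
        rw [w2, zpow_neg]; field_simp [zpow_ne_zero j h0]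
      rw [show (N : ℤ) - (j - 1) = N + 1 - j by ring, show (N : ℤ) + (j - 1) = N + j - 1 by ring,
        show (N : ℤ) - (j + 1) = N - j - 1 by ring, show (N : ℤ) + (j + 1) = N + 1 + j by ring,
        w1, w3, r3, r4, r1, r2]
      push_cast
      rw [show 2 * (N + 1) = 2 * N + 1 + 1 by ring, Finset.prod_range_succ,
        Finset.prod_range_succ, zpow_sub₀ hx, zpow_add₀ hx]
      simp only [zpow_add₀ h0, zpow_sub₀ h0, zpow_neg, zpow_one, zpow_natCast, pow_add, pow_mul,
        pow_one]
      have hj := zpow_ne_zero j h0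
      generalize q ^ j = y at *
      field_simp
      ring
    · rw [Finset.prod_range_succ, Finset.prod_range_succ]
      field_simp
      ring

theorem fin_vanish {q : ℂ} (h0 : q ≠ 0) (h1 : ‖q‖ < 1) (w : ℤ → ℂ)
    (hw : ∀ j, w (j + 1) = -q ^ (j + 1) * w j) (M N : ℕ) :
    HasSum (fun j : ℤ => w j * q ^ (-j) * (ipoch q (M + 1 - j) * ipoch q (N + j))) 0 := by
  have key : ∀ (M : ℕ) (j : ℤ),
      w j * q ^ (-j) * (ipoch q (M + 1 - j) * ipoch q (N + j)) =
      (1 - q ^ (M + 1 + N))⁻¹ * (w j * q ^ (-j) * (ipoch q (M - j) * ipoch q (N + j)) -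
        q ^ M * (w (j - 1) * q ^ (-(j - 1)) * (ipoch q (M - (j - 1)) * ipoch q (N + (j - 1))))) := by
    intro M j
    have r1 := ipoch_rec h1 (M + 1 - j)
    have r2 := ipoch_rec h1 (N + j)
    rw [show (M : ℤ) + 1 - j - 1 = M - j by ring] at r1
    have w2 := hw (j - 1)
    rw [sub_add_cancel] at w2
    have w3 : w (j - 1) = - q ^ (-j) * w j := by
      rw [w2, zpow_neg]; field_simp [zpow_ne_zero j h0]
    have h3 := one_sub_qpow_ne h1 (M + N)
    rw [show M + N + 1 = M + 1 + N by ring] at h3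
    rw [show (M : ℤ) - (j - 1) = M + 1 - j by ring, show (N : ℤ) + (j - 1) = N + j - 1 by ring,
      r1, r2, w3, eq_inv_mul_iff_mul_eq₀ h3]
    simp only [zpow_add₀ h0, zpow_sub₀ h0, zpow_neg, zpow_one, zpow_natCast, pow_add, pow_mul,
        pow_one]
    have hj := zpow_ne_zero j h0
    generalize q ^ j = y at *
    field_simp
    ring
  induction M with
  | zero =>
    have hs : Summable (fun j : ℤ => w j * q ^ (-j) *
        (ipoch q (((0 : ℕ) : ℤ) - j) * ipoch q (N + j))) := by
      apply summable_of_ne_finset_zero (s := Finset.Icc (-(N : ℤ)) 0)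
      intro j hj
      rw [Finset.mem_Icc, not_and_or] at hj
      rcases hj with h | h
      · simp [ipoch_neg (show (N : ℤ) + j < 0 by omega)]
      · simp [ipoch_neg (show - j < 0 by omega)]
    obtain ⟨a, ha⟩ := hs
    have a2 := ((Equiv.subRight (1 : ℤ)).hasSum_iff.mpr ha).mul_left (q ^ 0)
    have a3 := (ha.sub a2).mul_left (1 - q ^ (0 + 1 + N))⁻¹
    simp only [Function.comp, Equiv.subRight_apply] at a3
    refine hs_congr a3 ?_ ?_
    · intro j; exact key 0 j
    · simp
  | succ M ih =>
    have a2 := ((Equiv.subRight (1 : ℤ)).hasSum_iff.mpr ih).mul_left (q ^ (M + 1))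
    have a3 := (ih.sub a2).mul_left (1 - q ^ (M + 1 + 1 + N))⁻¹
    simp only [Function.comp, Equiv.subRight_apply] at a3
    refine hs_congr a3 ?_ ?_
    · intro j
      have := key (M + 1) j
      push_cast at this ⊢
      exact this
    · simp

theorem fin_vanish' {q : ℂ} (h0 : q ≠ 0) (h1 : ‖q‖ < 1) (w : ℤ → ℂ)
    (hw : ∀ j, w (j + 1) = -q ^ (j + 1) * w j) (M N : ℕ) :
    HasSum (fun j : ℤ => w j * (ipoch q (M - j) * ipoch q (N + 1 + j))) 0 := by
  have := fin_vanish h0 h1 (fun j => w (-j) * q ^ j) (fun j => by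
    have w2 := hw (-(j + 1))
    rw [show -(j + 1) + 1 = -j by ring] at w2
    have hj := zpow_ne_zero j h0
    simp only [w2, zpow_neg, zpow_add₀ h0, zpow_one]
    field_simp) N M
  rw [← (Equiv.neg ℤ).hasSum_iff] at this
  convert this using 1
  funext j
  have hj := zpow_ne_zero j h0
  simp only [Function.comp, Equiv.neg_apply, neg_neg, zpow_neg, ← sub_eq_add_neg,
    sub_neg_eq_add]
  field_simp

theorem fin_pf {q : ℂ} (h0 : q ≠ 0) (h1 : ‖q‖ < 1) (w : ℤ → ℂ) (w0 : w 0 = 1)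
    (hw : ∀ j, w (j + 1) = -q ^ (j + 1) * w j) (x : ℂ) (hx : x ≠ 0)
    (hxq : ∀ j : ℤ, 1 - x * q ^ j ≠ 0) (M N : ℕ) :
    HasSum (fun j : ℤ => w j / (1 - x * q ^ j) * (ipoch q (M - j) * ipoch q (N + j)))
      ((1 - x) * ((∏ i ∈ Finset.range M, (1 - x * q ^ (i + 1))) *
        ∏ i ∈ Finset.range N, (1 - q ^ (i + 1) / x)))⁻¹ := by
  induction M with
  | zero =>
    induction N with
    | zero =>
      convert hasSum_single (0 : ℤ) ?_ using 1
      · simp [w0, ipoch_zero]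
      · intro j hj
        rcases lt_or_gt_of_ne hj with h | h
        · simp [ipoch_neg h]
        · simp [ipoch_neg (show -j < 0 by omega)]
    | succ N ih =>
      have hne : 1 - q ^ (N + 1) / x ≠ 0 := by
        have := hxq (-(N + 1 : ℕ))
        rw [zpow_neg, zpow_natCast] at this
        have hq := pow_ne_zero (N + 1) h0
        intro h
        apply this
        field_simp at h ⊢
        linear_combination -h
      have a := (ih.sub ((fin_vanish' h0 h1 w hw 0 N).mul_left (q ^ (N + 1) / x))).mul_left
        (1 - q ^ (N + 1) / x)⁻¹
      refine hs_congr a ?_ ?_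
      · intro j
        rw [eq_inv_mul_iff_mul_eq₀ hne]
        have r := ipoch_rec h1 (N + 1 + j)
        rw [show (N : ℤ) + 1 + j - 1 = N + j by ring] at r
        rw [r]
        have hj := zpow_ne_zero j h0
        have hd := hxq j
        push_cast
        simp only [zpow_add₀ h0, zpow_one, zpow_natCast, pow_add, pow_one]
        generalize q ^ j = y at *
        field_simp
        ring
      · rw [Finset.prod_range_succ, sub_eq_add_neg _ (_ * 0), mul_zero, neg_zero, add_zero,
          ← mul_inv]
        congr 1
        ring
  | succ M ih =>
    have hne : 1 - x * q ^ (M + 1) ≠ 0 := by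
      have := hxq (M + 1 : ℕ)
      rwa [zpow_natCast] at this
    have a := (ih.add ((fin_vanish h0 h1 w hw M N).mul_left (q ^ (M + 1)))).mul_left
      (1 - x * q ^ (M + 1))⁻¹
    refine hs_congr a ?_ ?_
    · intro j
      rw [eq_inv_mul_iff_mul_eq₀ hne]
      have r := ipoch_rec h1 (M + 1 - j)
      rw [show (M : ℤ) + 1 - j - 1 = M - j by ring] at r
      rw [r]
      have hj := zpow_ne_zero j h0
      have hd := hxq j
      push_cast
      simp only [zpow_add₀ h0, zpow_sub₀ h0, zpow_neg, zpow_one, zpow_natCast, pow_add, pow_one]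
      generalize q ^ j = y at *
      field_simp
      ring
    · rw [Finset.prod_range_succ, mul_zero, add_zero, ← mul_inv]
      congr 1
      ring

open Filter Topology in
theorem ipoch_tendsto {q : ℂ} (h1 : ‖q‖ < 1) :
    Tendsto (ipoch q) atTop (𝓝 (∏' i : ℕ, (1 - q ^ (i + 1)))⁻¹) ∧
    (∏' i : ℕ, (1 - q ^ (i + 1))) ≠ 0 ∧ ∃ C : ℝ, 0 ≤ C ∧ ∀ n, ‖ipoch q n‖ ≤ C := by
  have hE : (∏' i : ℕ, (1 - q ^ (i + 1))) ≠ 0 := by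
    have := tprod_one_add_ne_zero_of_summable (f := fun i : ℕ => -q ^ (i + 1))
      (fun i => by simpa [sub_eq_add_neg] using one_sub_qpow_ne h1 i)
      (by simpa using (summable_nat_add_iff 1).mpr
            (summable_geometric_of_lt_one (norm_nonneg _) h1))
    simpa [sub_eq_add_neg] using this
  have ht := ((ModularForm.multipliable_one_sub_pow h1).tendsto_prod_tprod_nat).inv₀ hE
  refine ⟨?_, hE, ?_⟩
  · have h2 : Tendsto Int.toNat atTop atTop := by
      refine tendsto_atTop.mpr fun b => ?_
      filter_upwards [eventually_ge_atTop (b : ℤ)] with n hn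
      omega
    refine (ht.comp h2).congr' ?_
    filter_upwards [eventually_ge_atTop 0] with n hn
    simp [ipoch, hn]
  · obtain ⟨C, hC⟩ := ht.norm.bddAbove_range
    refine ⟨max C 0, le_max_right _ _, fun n => ?_⟩
    unfold ipoch
    split_ifs
    · exact le_max_of_le_left (hC ⟨n.toNat, rfl⟩)
    · simp

open Filter Topology in
theorem sum_lim {q : ℂ} (h1 : ‖q‖ < 1) (a : ℤ → ℂ) (ha : Summable a) :
    Tendsto (fun N : ℕ => ∑' j : ℤ, a j * (ipoch q (N - j) * ipoch q (N + j))) atTop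
      (𝓝 ((∑' j, a j) * ((∏' i : ℕ, (1 - q ^ (i + 1)))⁻¹ * (∏' i : ℕ, (1 - q ^ (i + 1)))⁻¹))) := by
  obtain ⟨ht, hE, C, hC0, hC⟩ := ipoch_tendsto h1
  rw [← tsum_mul_right]
  refine tendsto_tsum_of_dominated_convergence (bound := fun j => ‖a j‖ * (C * C))
    (ha.norm.mul_right _) ?_ ?_
  · intro j
    refine Tendsto.const_mul _ (Tendsto.mul ?_ ?_)
    · refine ht.comp ?_
      exact tendsto_atTop_add_const_right _ (-j) tendsto_natCast_atTop_atTop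
    · refine ht.comp ?_
      exact tendsto_atTop_add_const_right _ j tendsto_natCast_atTop_atTop
  · refine Eventually.of_forall fun N j => ?_
    rw [norm_mul, norm_mul]
    gcongr
    · exact hC _
    · exact hC _

open Filter Topology in
theorem prod_lim {q : ℂ} (h1 : ‖q‖ < 1) (x : ℂ) :
    Multipliable fun i : ℕ => 1 - x * q ^ (i + 1) := by
  have := multipliable_one_add_of_summable (f := fun i : ℕ => -(x * q ^ (i + 1)))
    (by simpa using ((summable_nat_add_iff 1).mpr
            (summable_geometric_of_lt_one (norm_nonneg _) h1)).mul_left ‖x‖)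
  simpa [sub_eq_add_neg] using this

open Filter Topology in
theorem main_q {q : ℂ} (h0 : q ≠ 0) (h1 : ‖q‖ < 1) (w : ℤ → ℂ) (w0 : w 0 = 1)
    (hw : ∀ j, w (j + 1) = -q ^ (j + 1) * w j) (x : ℂ) (hx : x ≠ 0)
    (hxq : ∀ j : ℤ, 1 - x * q ^ j ≠ 0)
    (sA : Summable fun j : ℤ => w j / (1 - x * q ^ j))
    (sT : Summable fun j : ℤ => w j * x ^ j) :
    (∑' j : ℤ, w j / (1 - x * q ^ j)) * x * (∑' j : ℤ, w j * x ^ j) =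
      -(∏' i : ℕ, (1 - q ^ (i + 1))) ^ 3 ∧ (∏' i : ℕ, (1 - q ^ (i + 1))) ≠ 0 := by
  have lA := sum_lim h1 _ sA
  have lT := sum_lim h1 _ sT
  obtain ⟨-, hE, -⟩ := ipoch_tendsto h1
  have tE := (ModularForm.multipliable_one_sub_pow h1).tendsto_prod_tprod_nat
  have tF := (prod_lim h1 x).tendsto_prod_tprod_nat
  have tG := (prod_lim h1 x⁻¹).tendsto_prod_tprod_nat
  set A := ∑' j : ℤ, w j / (1 - x * q ^ j)
  set T := ∑' j : ℤ, w j * x ^ j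
  set E := ∏' i : ℕ, (1 - q ^ (i + 1))
  set F := ∏' i : ℕ, (1 - x * q ^ (i + 1))
  set G := ∏' i : ℕ, (1 - x⁻¹ * q ^ (i + 1))
  have e1 : (1 - x) * (F * G) * (A * (E⁻¹ * E⁻¹)) = 1 := by
    refine tendsto_nhds_unique (((tF.mul tG).const_mul (1 - x)).mul lA) ?_
    refine tendsto_const_nhds.congr fun N => ?_
    rw [(fin_pf h0 h1 w w0 hw x hx hxq N N).tsum_eq]
    simp only [div_eq_inv_mul]
    rw [mul_inv_cancel₀]
    have hx1 := hxq 0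
    simp only [zpow_zero, mul_one] at hx1
    refine mul_ne_zero hx1 (mul_ne_zero ?_ ?_)
    · refine Finset.prod_ne_zero_iff.mpr fun i _ => ?_
      exact_mod_cast hxq (i + 1 : ℕ)
    · refine Finset.prod_ne_zero_iff.mpr fun i _ => ?_
      have := hxq (-(i + 1 : ℕ))
      rw [zpow_neg, zpow_natCast] at this
      have hq := pow_ne_zero (i + 1) h0
      intro h
      apply this
      field_simp at h ⊢
      linear_combination -h
  have e2 : E * (T * (E⁻¹ * E⁻¹)) = F * ((1 - x⁻¹) * G) := by
    have tE2 : Tendsto (fun N : ℕ => ∏ i ∈ Finset.range (2 * N), (1 - q ^ (i + 1))) atTop (𝓝 E) :=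
      tE.comp (tendsto_id.const_mul_atTop' (by norm_num : 0 < 2))
    have tH : Tendsto (fun N : ℕ => ∏ i ∈ Finset.range N, (1 - q ^ i / x)) atTop
        (𝓝 ((1 - x⁻¹) * G)) := by
      rw [← tendsto_add_atTop_iff_nat 1]
      refine (tG.const_mul (1 - x⁻¹)).congr fun N => ?_
      rw [Finset.prod_range_succ', mul_comm]
      simp [div_eq_inv_mul]
    refine tendsto_nhds_unique ((tE2.mul lT).congr fun N => ?_) (tF.mul tH)
    rw [← tsum_mul_left]
    exact (fin_triple h0 h1 w w0 hw x hx N).tsum_eq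
  refine ⟨?_, hE⟩
  have hFG : (1 - x) * (F * G) * A = E ^ 2 := by
    field_simp at e1
    linear_combination e1
  have hT : T * x = F * ((x - 1) * G) * E := by
    field_simp at e2
    linear_combination e2
  linear_combination A * hT - E * hFG

theorem e2_add (a b : ℂ) : e2 (a + b) = e2 a * e2 b := by
  simp [e2, mul_add, Complex.exp_add]

theorem e2_ne (a : ℂ) : e2 a ≠ 0 := Complex.exp_ne_zero _

theorem e2_zpow (a : ℂ) (j : ℤ) : e2 a ^ j = e2 (j * a) := by
  rw [e2, e2, ← Complex.exp_int_mul]; congr 1; ring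

theorem e2_pow (a : ℂ) (j : ℕ) : e2 a ^ j = e2 (j * a) := by
  rw [e2, e2, ← Complex.exp_nat_mul]; congr 1; ring

theorem e2_norm {τ : ℂ} (hτ : 0 < τ.im) : ‖e2 τ‖ < 1 := by
  have := UpperHalfPlane.norm_exp_two_pi_I_lt_one ⟨τ, hτ⟩
  simpa [e2] using this

/-- the theta coefficients -/
def wt (τ : ℂ) (j : ℤ) : ℂ := (-1) ^ j * e2 (((j : ℂ) ^ 2 + j) / 2 * τ)

theorem wt_rec (τ : ℂ) (j : ℤ) : wt τ (j + 1) = -e2 τ ^ (j + 1) * wt τ j := by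
  unfold wt
  rw [e2_zpow, zpow_add₀ (by norm_num), zpow_one]
  have : e2 ((((j + 1 : ℤ) : ℂ) ^ 2 + (j + 1 : ℤ)) / 2 * τ) =
      e2 ((j + 1 : ℤ) * τ) * e2 (((j : ℂ) ^ 2 + j) / 2 * τ) := by
    rw [← e2_add]; congr 1; push_cast; ring
  rw [this]; ring

theorem wt_summable {τ : ℂ} (hτ : 0 < τ.im) (z : ℂ) :
    Summable fun j : ℤ => wt τ j * e2 z ^ j := by
  refine ((summable_jacobiTheta₂_term_iff (z + τ / 2 + 1 / 2) τ).mpr hτ).congr fun j => ?_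
  rw [wt, e2_zpow, mul_assoc, ← e2_add]
  have : (-1 : ℂ) ^ j = e2 (j / 2) := by
    rw [show (-1 : ℂ) = e2 (1 / 2) by
      rw [e2, ← Complex.exp_pi_mul_I]; congr 1; ring, e2_zpow]
    congr 1; ring
  rw [this, ← e2_add, jacobiTheta₂_term, e2]
  congr 1; ring

open Filter Topology in
theorem frac_summable {q : ℂ} (h0 : q ≠ 0) (h1 : ‖q‖ < 1) (x : ℂ) (hx : x ≠ 0) (a : ℤ → ℂ)
    (ha : Summable a) : Summable fun j : ℤ => a j / (1 - x * q ^ j) := by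
  refine (ha.norm.mul_left 2).of_norm_bounded_eventually ?_
  have key : ∀ᶠ j : ℤ in cofinite, 1 / 2 ≤ ‖1 - x * q ^ j‖ := by
    have hp : Tendsto (fun n : ℕ => ‖x‖ * ‖q‖ ^ n) atTop (𝓝 0) := by
      simpa using (tendsto_pow_atTop_nhds_zero_of_lt_one (norm_nonneg q) h1).const_mul ‖x‖
    have hm : Tendsto (fun n : ℕ => ‖x‖⁻¹ * ‖q‖ ^ n) atTop (𝓝 0) := by
      simpa using (tendsto_pow_atTop_nhds_zero_of_lt_one (norm_nonneg q) h1).const_mul ‖x‖⁻¹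
    obtain ⟨n1, hn1⟩ := eventually_atTop.mp (hp.eventually_lt_const (show (0 : ℝ) < 1 / 2 by norm_num))
    obtain ⟨n2, hn2⟩ := eventually_atTop.mp (hm.eventually_lt_const (show (0 : ℝ) < 1 / 2 by norm_num))
    rw [Int.cofinite_eq, eventually_sup]
    constructor
    · filter_upwards [eventually_le_atBot (-(n2 : ℤ))] with j hj
      obtain ⟨m, rfl⟩ : ∃ m : ℕ, j = -m := ⟨(-j).toNat, by omega⟩
      have h3 := hn2 m (by omega)
      have h4 : ‖x * q ^ (-(m : ℤ))‖ = (‖x‖⁻¹ * ‖q‖ ^ m)⁻¹ := by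
        rw [norm_mul, zpow_neg, norm_inv, zpow_natCast, norm_pow, mul_inv, inv_inv]
      have h5 : 2 ≤ ‖x * q ^ (-(m : ℤ))‖ := by
        rw [h4, le_inv_comm₀ (by norm_num) (by positivity)]
        linarith
      have h6 := norm_sub_norm_le (x * q ^ (-(m : ℤ))) 1
      rw [norm_sub_rev, norm_one] at h6
      linarith
    · filter_upwards [eventually_ge_atTop (n1 : ℤ)] with j hj
      obtain ⟨m, rfl⟩ : ∃ m : ℕ, j = m := ⟨j.toNat, by omega⟩
      have h3 := hn1 m (by omega)
      have h4 : ‖x * q ^ (m : ℤ)‖ = ‖x‖ * ‖q‖ ^ m := by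
        rw [norm_mul, zpow_natCast, norm_pow]
      have h6 := norm_sub_norm_le 1 (x * q ^ (m : ℤ))
      rw [norm_one] at h6
      linarith
  filter_upwards [key] with j hj
  rw [norm_div, div_le_iff₀ (by linarith)]
  nlinarith [norm_nonneg (a j)]

theorem wt_vanish (τ : ℂ) (n : ℤ) : ∑' j : ℤ, wt τ j * e2 τ ^ (n * j) = 0 := by
  have h := (Equiv.subLeft (-2 * n - 1 : ℤ)).tsum_eq (fun j : ℤ => wt τ j * e2 τ ^ (n * j))
  have h2 : ∀ j : ℤ, wt τ (Equiv.subLeft (-2 * n - 1 : ℤ) j) *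
      e2 τ ^ (n * (Equiv.subLeft (-2 * n - 1 : ℤ) j)) = -(wt τ j * e2 τ ^ (n * j)) := by
    intro j
    simp only [Equiv.subLeft_apply, wt, e2_zpow, mul_assoc, ← e2_add]
    have : (-1 : ℂ) ^ (-2 * n - 1 - j) = -(-1) ^ j := by
      have hm : (-1 : ℂ) ≠ 0 := by norm_num
      rw [zpow_sub₀ hm, zpow_sub₀ hm, zpow_mul]
      rcases Int.even_or_odd j with hj | hj
      · simp [hj.neg_one_zpow]
      · simp [hj.neg_one_zpow]
    rw [this, neg_mul]
    congr 3
    push_cast; ring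
  simp only [h2, tsum_neg] at h
  have := self_eq_neg.mp h.symm
  exact this

theorem B_eq {τ : ℂ} (hτ : 0 < τ.im) (z : ℂ) (hxq : ∀ j : ℤ, 1 - e2 z * e2 τ ^ j ≠ 0) (n : ℤ) :
    ∑' j : ℤ, wt τ j * e2 τ ^ (n * j) / (1 - e2 z * e2 τ ^ j) =
      e2 z ^ (-n) * ∑' j : ℤ, wt τ j / (1 - e2 z * e2 τ ^ j) := by
  have hs : ∀ n : ℤ, Summable fun j : ℤ => wt τ j * e2 τ ^ (n * j) := fun n => by
    refine (wt_summable hτ (n * τ)).congr fun j => ?_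
    rw [← e2_zpow, zpow_mul]
  have hs2 : ∀ n : ℤ, Summable fun j : ℤ => wt τ j * e2 τ ^ (n * j) / (1 - e2 z * e2 τ ^ j) :=
    fun n => frac_summable (e2_ne _) (e2_norm hτ) _ (e2_ne _) _ (hs n)
  have step : ∀ n : ℤ, ∑' j : ℤ, wt τ j * e2 τ ^ (n * j) / (1 - e2 z * e2 τ ^ j) =
      e2 z * ∑' j : ℤ, wt τ j * e2 τ ^ ((n + 1) * j) / (1 - e2 z * e2 τ ^ j) := by
    intro n
    rw [← sub_eq_zero, ← tsum_mul_left, ← (hs2 n).tsum_sub ((hs2 (n + 1)).mul_left _),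
      ← wt_vanish τ n]
    refine tsum_congr fun j => ?_
    have hd := hxq j
    rw [add_mul, one_mul, zpow_add₀ (e2_ne τ)]
    field_simp
  have hz := e2_ne z
  induction n using Int.induction_on with
  | zero => simp
  | succ n ih =>
    have := step n
    rw [ih] at this
    rw [neg_add, zpow_add₀ hz, mul_comm (e2 z ^ _) (e2 z ^ _), mul_assoc, this, zpow_neg_one,
      inv_mul_cancel_left₀ hz]
  | pred n ih =>
    have := step (-n - 1)
    rw [sub_add_cancel, ih] at this
    rw [this, ← mul_assoc, ← zpow_one_add₀ hz]
    congr 2; ring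

theorem stmt_3 (S : ℤ) (s : ℂ) (hs : s = (S : ℂ) + 1 / 2) (k : ℤ)
    (τ : ℂ) (hτ : 0 < τ.im) (z : ℂ)
    (hz : ∀ a b : ℤ, z ≠ (a : ℂ) + (b : ℂ) * τ) :
    Phi1 (-1) (1 / 2) s τ z (-z + 2 * (k : ℂ) * τ) =
      -Complex.I * e2 (-((k : ℂ) * z)) * dedekindEta τ ^ 3 / theta11 τ z := by
  have hxq : ∀ j : ℤ, 1 - e2 z * e2 τ ^ j ≠ 0 := by
    intro j h
    rw [e2_zpow, ← e2_add, sub_eq_zero, eq_comm, e2, Complex.exp_eq_one_iff] at h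
    obtain ⟨n, hn⟩ := h
    apply hz n (-j)
    have h2 : (2 * (Real.pi : ℂ) * Complex.I) ≠ 0 := Complex.two_pi_I_ne_zero
    have : z + j * τ = n := mul_left_cancel₀ h2 (by rw [hn]; ring)
    push_cast
    linear_combination this
  have hP : Phi1 (-1) (1 / 2) s τ z (-z + 2 * (k : ℂ) * τ) =
      e2 (z / 2 - k * z) * ∑' j : ℤ, wt τ j / (1 - e2 z * e2 τ ^ j) := by
    have : e2 (z / 2 - k * z) = e2 (s * z) * e2 z ^ (-(S + k)) := by
      rw [e2_zpow, ← e2_add, hs]; congr 1; push_cast; ring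
    rw [this, mul_assoc (e2 (s * z)), ← B_eq hτ z hxq, ← tsum_mul_left, Phi1]
    refine tsum_congr fun j => ?_
    have e1 : e2 (1 / 2 * (j : ℂ) * (z + (-z + 2 * (k : ℂ) * τ)) + s * z +
        (1 / 2 * (j : ℂ) ^ 2 + s * (j : ℂ)) * τ) =
        e2 (s * z) * (e2 (((j : ℂ) ^ 2 + j) / 2 * τ) * e2 τ ^ ((S + k) * j)) := by
      rw [e2_zpow, ← e2_add, ← e2_add, hs]; congr 1; push_cast; ring
    rw [e1, e2_add, ← e2_zpow, wt]
    ring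
  have hT : theta11 τ z = Complex.I * (e2 (τ / 8) * e2 (z / 2)) *
      ∑' j : ℤ, wt τ j * e2 z ^ j := by
    rw [theta11, mul_assoc]
    congr 1
    rw [← tsum_mul_left]
    refine tsum_congr fun j => ?_
    rw [wt, e2_zpow]
    have e1 : e2 (((j : ℂ) + 1 / 2) ^ 2 / 2 * τ + ((j : ℂ) + 1 / 2) * z) =
        e2 (τ / 8) * e2 (z / 2) * (e2 (((j : ℂ) ^ 2 + j) / 2 * τ) * e2 (j * z)) := by
      simp only [← e2_add]; congr 1; ring
    rw [e1]; ring
  have hE : dedekindEta τ ^ 3 = e2 (τ / 8) * (∏' i : ℕ, (1 - e2 τ ^ (i + 1))) ^ 3 := by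
    rw [dedekindEta, mul_pow, e2_pow]
    congr 2
    · push_cast; ring
    · refine tprod_congr fun i => ?_
      rw [e2_pow]; push_cast; rfl
  obtain ⟨hm, hne⟩ := main_q (e2_ne τ) (e2_norm hτ) (wt τ) (by simp [wt, e2]) (wt_rec τ) (e2 z)
    (e2_ne z) hxq
    (frac_summable (e2_ne _) (e2_norm hτ) _ (e2_ne _) _ (by simpa [e2] using wt_summable hτ 0))
    (wt_summable hτ z)
  have hTne : (∑' j : ℤ, wt τ j * e2 z ^ j) ≠ 0 := by
    intro h
    rw [h, mul_zero] at hm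
    exact hne (pow_eq_zero_iff (n := 3) (by norm_num) |>.mp (neg_eq_zero.mp hm.symm))
  have hzz : e2 z = e2 (z / 2) * e2 (z / 2) := by rw [← e2_add]; congr 1; ring
  have hk : e2 (z / 2 - k * z) = e2 (z / 2) * e2 (-(k * z)) := by
    rw [← e2_add]; congr 1
  rw [hP, hT, hE, hk]
  have n1 := e2_ne (τ / 8)
  have n2 := e2_ne (z / 2)
  rw [eq_div_iff (mul_ne_zero (mul_ne_zero Complex.I_ne_zero (mul_ne_zero n1 n2)) hTne)]
  generalize (∑' j : ℤ, wt τ j * e2 z ^ j) = T at *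
  generalize (∑' j : ℤ, wt τ j / (1 - e2 z * e2 τ ^ j)) = A at *
  rw [hzz] at hm
  linear_combination (e2 (-(k * z)) * Complex.I * e2 (τ / 8)) * hm
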